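/- Let X be a proper Busemann space and c : [0,∞) → X a ray with c(0) = x₀. Then: (a) for every y ∈ X the limit β_c(y) = lim_{t→∞}(d(y,c(t)) − t) exists; (b) β_c is a horofunction based at x₀ (it is the pointwise limit of the functions y ↦ d(y,c(k)) − d(x₀,c(k)) as k → ∞); (c) for every t ≥ 0, β_c(c(t)) = −t, β_c(y) ≥ −t for every y with d(x₀,y) ≤ t, and c(t) is the unique point of the closed ball of radius t about x₀ at which β_c attains the value −t. Consequently the ray associated to the horofunction β_c is c itself, so every ray arises from a horofunction in this way. -/

import Mathlib

open Filter

def IsGeodesicSeg {X : Type*} [MetricSpace X] (γ : ℝ → X) (x y : X) : Prop :=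
  γ 0 = x ∧ γ 1 = y ∧
    ∀ s ∈ Set.Icc (0 : ℝ) 1, ∀ t ∈ Set.Icc (0 : ℝ) 1,
      dist (γ s) (γ t) = |s - t| * dist x y

def IsBusemannSpace (X : Type*) [MetricSpace X] : Prop :=
  (∀ x y : X, ∃ γ : ℝ → X, IsGeodesicSeg γ x y) ∧
    ∀ (γ₁ γ₂ : ℝ → X) (x y₁ y₂ : X), IsGeodesicSeg γ₁ x y₁ → IsGeodesicSeg γ₂ x y₂ →
      ∀ t ∈ Set.Icc (0 : ℝ) 1, dist (γ₁ t) (γ₂ t) ≤ t * dist y₁ y₂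

def IsRay {X : Type*} [MetricSpace X] (c : ℝ → X) : Prop :=
  ∀ s t : ℝ, 0 ≤ s → 0 ≤ t → dist (c s) (c t) = |s - t|

theorem isGeodesicSeg_of_dist_le {X : Type*} [MetricSpace X] {γ : ℝ → X} {x y : X}
    (h0 : γ 0 = x) (h1 : γ 1 = y)
    (h : ∀ s t : ℝ, 0 ≤ s → s ≤ t → t ≤ 1 → dist (γ s) (γ t) ≤ (t - s) * dist x y) :
    IsGeodesicSeg γ x y := by
  have key : ∀ s t : ℝ, 0 ≤ s → s ≤ t → t ≤ 1 →
      dist (γ s) (γ t) = (t - s) * dist x y := by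
    intro s t hs hst ht
    refine le_antisymm (h s t hs hst ht) ?_
    have hleft := h 0 s le_rfl hs (hst.trans ht)
    have hright := h t 1 (hs.trans hst) ht le_rfl
    have htri := dist_triangle4 (γ 0) (γ s) (γ t) (γ 1)
    rw [h0] at hleft htri
    rw [h1] at hright htri
    linarith
  refine ⟨h0, h1, fun s hs t ht => ?_⟩
  rcases le_total s t with hst | hst
  · rw [key s t hs.1 hst ht.2, abs_of_nonpos (by linarith)]
    ring
  · rw [dist_comm, key t s ht.1 hst hs.2, abs_of_nonneg (by linarith)]

/-- Two geodesics concatenate to a geodesic when the triangle inequality is an equality. -/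
theorem IsGeodesicSeg.exists_concat {X : Type*} [MetricSpace X] {γ₁ γ₂ : ℝ → X} {x y z : X}
    (h₁ : IsGeodesicSeg γ₁ x y) (h₂ : IsGeodesicSeg γ₂ y z)
    (hxy : 0 < dist x y) (hyz : 0 < dist y z) (hxz : dist x z = dist x y + dist y z) :
    ∃ γ : ℝ → X, IsGeodesicSeg γ x z ∧ γ (dist x y / dist x z) = y := by
  obtain ⟨h₁0, h₁1, h₁d⟩ := h₁
  obtain ⟨h₂0, h₂1, h₂d⟩ := h₂
  set a := dist x y with ha
  set b := dist y z with hb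
  have hL : 0 < a + b := by linarith
  have haL : a / (a + b) * (a + b) = a := by field_simp
  set γ : ℝ → X := fun u =>
    if u ≤ a / (a + b) then γ₁ (u * (a + b) / a) else γ₂ ((u * (a + b) - a) / b) with hγ
  have hmid : γ (a / (a + b)) = y := by
    simp only [hγ, le_refl, if_true, haL]
    rw [div_self hxy.ne', h₁1]
  have hleft : ∀ s t : ℝ, 0 ≤ s → s ≤ t → t ≤ a / (a + b) →
      dist (γ s) (γ t) = (t - s) * (a + b) := by
    intro s t hs hst ht
    have htL : t * (a + b) ≤ a := (le_div_iff₀ hL).1 ht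
    have hsL : s * (a + b) ≤ t * (a + b) := by gcongr
    have hs0 : 0 ≤ s * (a + b) := by positivity
    simp only [hγ, if_pos ht, if_pos (hst.trans ht)]
    rw [h₁d _ ⟨by positivity, (div_le_one hxy).2 (hsL.trans htL)⟩ _
      ⟨div_nonneg (hs0.trans hsL) hxy.le, (div_le_one hxy).2 htL⟩, ← sub_div, abs_div,
      abs_of_pos hxy, abs_of_nonpos (by linarith)]
    field_simp
    ring
  have hγ₂ : ∀ t : ℝ, a / (a + b) ≤ t → γ t = γ₂ ((t * (a + b) - a) / b) := by
    intro t ht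
    rcases ht.eq_or_lt with rfl | ht
    · rw [hmid, haL, sub_self, zero_div, h₂0]
    · simp only [hγ, if_neg ht.not_ge]
  have hright : ∀ s t : ℝ, a / (a + b) ≤ s → s ≤ t → t ≤ 1 →
      dist (γ s) (γ t) = (t - s) * (a + b) := by
    intro s t hs hst ht
    have hs0 : a ≤ s * (a + b) := (div_le_iff₀ hL).1 hs
    have hsL : s * (a + b) ≤ t * (a + b) := by gcongr
    have htL : t * (a + b) ≤ a + b := by nlinarith
    rw [hγ₂ s hs, hγ₂ t (hs.trans hst),
      h₂d _ ⟨div_nonneg (by linarith) hyz.le, (div_le_one hyz).2 (by linarith)⟩ _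
      ⟨div_nonneg (by linarith) hyz.le, (div_le_one hyz).2 (by linarith)⟩, ← sub_div, abs_div,
      abs_of_pos hyz, abs_of_nonpos (by linarith)]
    field_simp
    ring
  have hm0 : 0 ≤ a / (a + b) := by positivity
  have hm1 : a / (a + b) ≤ 1 := (div_le_one hL).2 (by linarith)
  refine ⟨γ, isGeodesicSeg_of_dist_le ?_ ?_ ?_, by rw [hxz]; exact hmid⟩
  · simp only [hγ, if_pos hm0, zero_mul, zero_div, h₁0]
  · rw [hγ₂ 1 hm1, one_mul, add_sub_cancel_left, div_self hyz.ne', h₂1]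
  · intro s t hs hst ht
    rw [hxz]
    rcases le_total t (a / (a + b)) with htm | htm
    · exact (hleft s t hs hst htm).le
    rcases le_total (a / (a + b)) s with hsm | hsm
    · exact (hright s t hsm hst ht).le
    · have := dist_triangle (γ s) (γ (a / (a + b))) (γ t)
      rw [hleft _ _ hs hsm le_rfl, hright _ _ le_rfl htm ht] at this
      linarith

theorem IsRay.isGeodesicSeg {X : Type*} [MetricSpace X] {c : ℝ → X} (hc : IsRay c)
    {a b : ℝ} (ha : 0 ≤ a) (hb : 0 ≤ b) :
    IsGeodesicSeg (fun u => c (a + u * (b - a))) (c a) (c b) := by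
  have hnonneg : ∀ u ∈ Set.Icc (0 : ℝ) 1, 0 ≤ a + u * (b - a) := by
    rintro u ⟨h0, h1⟩
    nlinarith [mul_nonneg h0 hb, mul_nonneg (sub_nonneg.2 h1) ha]
  refine ⟨by simp, by simp, fun s hs t ht => ?_⟩
  rw [hc _ _ (hnonneg s hs) (hnonneg t ht), hc a b ha hb, abs_sub_comm a b, ← abs_mul]
  ring_nf

theorem IsRay.dist_zero {X : Type*} [MetricSpace X] {c : ℝ → X} (hc : IsRay c)
    {t : ℝ} (ht : 0 ≤ t) : dist (c 0) (c t) = t := by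
  rw [hc 0 t le_rfl ht, zero_sub, abs_neg, abs_of_nonneg ht]

theorem IsRay.neg_dist_le {X : Type*} [MetricSpace X] {c : ℝ → X} (hc : IsRay c)
    (y : X) {t : ℝ} (ht : 0 ≤ t) : -dist (c 0) y ≤ dist y (c t) - t := by
  have := dist_triangle (c 0) y (c t)
  rw [hc.dist_zero ht] at this
  linarith

theorem IsRay.exists_tendsto_dist_sub {X : Type*} [MetricSpace X] {c : ℝ → X} (hc : IsRay c)
    (y : X) : ∃ b : ℝ, Tendsto (fun t : ℝ => dist y (c t) - t) atTop (nhds b) := by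
  have hanti : Antitone fun t : ℝ => dist y (c (max t 0)) - max t 0 := by
    intro s t hst
    have hmax : max s 0 ≤ max t 0 := max_le_max_right 0 hst
    have := dist_triangle y (c (max s 0)) (c (max t 0))
    rw [hc _ _ (le_max_right _ _) (le_max_right _ _), abs_of_nonpos (by linarith)] at this
    dsimp only
    linarith
  have hbdd : BddBelow (Set.range fun t : ℝ => dist y (c (max t 0)) - max t 0) := by
    refine ⟨-dist (c 0) y, ?_⟩
    rintro _ ⟨t, rfl⟩
    exact hc.neg_dist_le y (le_max_right _ _)
  refine ⟨_, (tendsto_atTop_ciInf hanti hbdd).congr' ?_⟩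
  filter_upwards [eventually_ge_atTop 0] with t ht
  rw [max_eq_left ht]

/-- A point of distance `r` from `y` towards a far away point of the ray. -/
theorem IsRay.exists_dist_ge_sub {X : Type*} [MetricSpace X] (hX : IsBusemannSpace X)
    {c : ℝ → X} (hc : IsRay c) {y : X} {t : ℝ} (hy : dist (c 0) y = t)
    (hlim : Tendsto (fun s : ℝ => dist y (c s) - s) atTop (nhds (-t)))
    {r ε : ℝ} (hr : 0 < r) (hε : 0 < ε) :
    ∃ p : X, dist y p ≤ r ∧ dist (c r) p ≤ 2 * t ∧ t + r - ε ≤ dist (c 0) p := by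
  have ht : 0 ≤ t := hy ▸ dist_nonneg
  obtain ⟨s, hsε, hsr⟩ := ((hlim.eventually (gt_mem_nhds (show -t < -t + ε by linarith))).and
    (eventually_ge_atTop (r + t))).exists
  have hs : 0 ≤ s := by linarith
  have hlow := hc.neg_dist_le y hs
  rw [hy] at hlow
  have hup : dist y (c s) ≤ t + s := by
    have := dist_triangle y (c 0) (c s)
    rwa [hc.dist_zero hs, dist_comm y (c 0), hy] at this
  rw [dist_comm y] at hsε hlow hup
  obtain ⟨γ, hγ⟩ := hX.1 (c s) y
  obtain ⟨hγ0, hγ1, hγd⟩ := id hγ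
  set D := dist (c s) y with hD
  have hrD : r ≤ D := by linarith
  have hD0 : 0 < D := by linarith
  have hq0 : 0 ≤ r / D := by positivity
  have hq1 : r / D ≤ 1 := (div_le_one hD0).2 hrD
  have hqD : r / D * D = r := by field_simp
  have hu : 1 - r / D ∈ Set.Icc (0 : ℝ) 1 := ⟨by linarith, by linarith⟩
  refine ⟨γ (1 - r / D), ?_, ?_, ?_⟩
  · have := hγd 1 ⟨zero_le_one, le_rfl⟩ _ hu
    rw [hγ1, sub_sub_cancel, abs_of_nonneg hq0, hqD] at this
    exact this.le
  · have hcmp := hX.2 _ γ _ _ _ (hc.isGeodesicSeg hs le_rfl) hγ _ hu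
    rw [hy] at hcmp
    rw [show s + (1 - r / D) * (0 - s) = r / D * s by ring] at hcmp
    have hle : (1 - r / D) * t ≤ t := by nlinarith
    have hpar : dist (c r) (c (r / D * s)) ≤ t := by
      rw [hc _ _ hr.le (by positivity), abs_le]
      constructor <;> nlinarith
    linarith [dist_triangle (c r) (c (r / D * s)) (γ (1 - r / D))]
  · have hdist := hγd 0 ⟨le_rfl, zero_le_one⟩ _ hu
    rw [hγ0, zero_sub, abs_neg, abs_of_nonneg hu.1, sub_mul, one_mul, hqD] at hdist
    have htri := dist_triangle (c 0) (γ (1 - r / D)) (c s)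
    rw [hc.dist_zero hs, dist_comm _ (c s), hdist] at htri
    linarith

theorem IsRay.exists_dist_eq_add {X : Type*} [MetricSpace X] [ProperSpace X]
    (hX : IsBusemannSpace X) {c : ℝ → X} (hc : IsRay c) {y : X} {t : ℝ}
    (hy : dist (c 0) y = t)
    (hlim : Tendsto (fun s : ℝ => dist y (c s) - s) atTop (nhds (-t)))
    {r : ℝ} (hr : 0 < r) :
    ∃ p : X, dist y p = r ∧ dist (c r) p ≤ 2 * t ∧ dist (c 0) p = t + r := by
  have hK : IsCompact (Metric.closedBall y r ∩ Metric.closedBall (c r) (2 * t)) :=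
    (isCompact_closedBall _ _).inter_right Metric.isClosed_closedBall
  have hne : (Metric.closedBall y r ∩ Metric.closedBall (c r) (2 * t)).Nonempty := by
    obtain ⟨p, hyp, hrp, -⟩ := hc.exists_dist_ge_sub hX hy hlim hr one_pos
    exact ⟨p, Metric.mem_closedBall'.2 hyp, Metric.mem_closedBall'.2 hrp⟩
  obtain ⟨p, ⟨hyp, hrp⟩, hmax⟩ := hK.exists_isMaxOn hne
    (continuous_const.dist continuous_id : Continuous fun p => dist (c 0) p).continuousOn
  rw [Metric.mem_closedBall'] at hyp hrp
  have hge : t + r ≤ dist (c 0) p := by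
    refine le_of_forall_pos_le_add fun ε hε => ?_
    obtain ⟨q, hyq, hrq, hq⟩ := hc.exists_dist_ge_sub hX hy hlim hr hε
    have : dist (c 0) q ≤ dist (c 0) p :=
      hmax ⟨Metric.mem_closedBall'.2 hyq, Metric.mem_closedBall'.2 hrq⟩
    linarith
  have htri := dist_triangle (c 0) y p
  rw [hy] at htri
  exact ⟨p, by linarith, hrp, by linarith⟩

theorem IsRay.eq_of_tendsto_neg {X : Type*} [MetricSpace X] [ProperSpace X]
    (hX : IsBusemannSpace X) {c : ℝ → X} (hc : IsRay c) {y : X} {t : ℝ}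
    (hy : dist (c 0) y = t)
    (hlim : Tendsto (fun s : ℝ => dist y (c s) - s) atTop (nhds (-t))) : y = c t := by
  have ht : 0 ≤ t := hy ▸ dist_nonneg
  rcases ht.eq_or_lt with rfl | htpos
  · exact (dist_eq_zero.1 hy).symm
  have hbound : ∀ r : ℝ, 0 < r → dist y (c t) ≤ t * (3 * t) / (t + r) := by
    intro r hr
    obtain ⟨p, hyp, hrp, hp⟩ := hc.exists_dist_eq_add hX hy hlim hr
    obtain ⟨γ₁, h₁⟩ := hX.1 (c 0) y
    obtain ⟨γ₂, h₂⟩ := hX.1 y p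
    obtain ⟨γ, hγ, hγy⟩ := h₁.exists_concat h₂ (by rwa [hy]) (by rwa [hyp]) (by rw [hp, hy, hyp])
    rw [hy, hp] at hγy
    have htr : 0 < t + r := by linarith
    have hcmp := hX.2 γ _ _ _ _ hγ (hc.isGeodesicSeg le_rfl htr.le) (t / (t + r))
      ⟨by positivity, (div_le_one htr).2 (by linarith)⟩
    have hpar : 0 + t / (t + r) * (t + r - 0) = t := by field_simp; ring
    rw [hγy, hpar] at hcmp
    have hend : dist p (c (t + r)) ≤ 3 * t := by
      have := dist_triangle p (c r) (c (t + r))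
      rw [hc _ _ hr.le htr.le, abs_of_nonpos (by linarith), dist_comm p (c r)] at this
      linarith
    calc dist y (c t) ≤ t / (t + r) * dist p (c (t + r)) := hcmp
      _ ≤ t / (t + r) * (3 * t) := by gcongr
      _ = t * (3 * t) / (t + r) := by ring
  have hzero : Tendsto (fun r : ℝ => t * (3 * t) / (t + r)) atTop (nhds 0) :=
    tendsto_const_nhds.div_atTop (tendsto_atTop_add_const_left _ _ tendsto_id)
  have hle : dist y (c t) ≤ 0 := by
    refine ge_of_tendsto hzero ?_
    filter_upwards [eventually_gt_atTop 0] with r hr using hbound r hr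
  exact dist_le_zero.1 hle

/-- The Busemann function of a ray: (a) the limit `β_c y = lim_{t→∞} (dist y (c t) - t)`
exists; (b) `β_c` is a horofunction based at `x₀ = c 0` (pointwise limit of
`y ↦ dist y (c k) - dist x₀ (c k)`); (c) `β_c (c t) = -t`, `β_c ≥ -t` on the closed ball
of radius `t` about `x₀`, and `c t` is the unique point of that ball with value `-t`. -/
theorem busemann_function_of_ray {X : Type*} [MetricSpace X] [ProperSpace X]
    (hX : IsBusemannSpace X) (c : ℝ → X) (hc : IsRay c) (x₀ : X) (hc0 : c 0 = x₀) :
    ∃ β : X → ℝ,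
      (∀ y : X, Tendsto (fun t : ℝ => dist y (c t) - t) atTop (nhds (β y))) ∧
      (Tendsto (fun k : ℕ => dist x₀ (c k)) atTop atTop ∧
        ∀ y : X, Tendsto (fun k : ℕ => dist y (c k) - dist x₀ (c k)) atTop (nhds (β y))) ∧
      (∀ t : ℝ, 0 ≤ t → β (c t) = -t ∧
        ∀ y : X, dist x₀ y ≤ t → (-t ≤ β y ∧ (β y = -t → y = c t))) := by
  subst hc0
  choose β hβ using hc.exists_tendsto_dist_sub
  have hβ_ge : ∀ y, -dist (c 0) y ≤ β y := by
    intro y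
    refine ge_of_tendsto (hβ y) ?_
    filter_upwards [eventually_ge_atTop 0] with t ht using hc.neg_dist_le y ht
  have hdist : ∀ k : ℕ, dist (c 0) (c k) = k := fun k => hc.dist_zero k.cast_nonneg
  refine ⟨β, hβ, ⟨?_, fun y => ?_⟩, fun t ht => ⟨?_, fun y hy => ⟨?_, fun hyt => ?_⟩⟩⟩
  · simpa only [hdist] using tendsto_natCast_atTop_atTop (R := ℝ)
  · simpa only [hdist, Function.comp_def] using (hβ y).comp tendsto_natCast_atTop_atTop
  · refine tendsto_nhds_unique (hβ (c t)) (tendsto_const_nhds.congr' ?_)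
    filter_upwards [eventually_ge_atTop t] with s hs
    rw [hc _ _ ht (ht.trans hs), abs_of_nonpos (by linarith)]
    ring
  · linarith [hβ_ge y]
  · refine hc.eq_of_tendsto_neg hX (le_antisymm hy ?_) (hyt ▸ hβ y)
    linarith [hβ_ge y]
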